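/- Let X be a normal random variable with mean μ and variance σ² > 0, let m, n be nonnegative integers with n ≥ 1, ℓ = max{m, n}, and let g : ℝ → ℝ be (ℓ−1)-times continuously differentiable with g^{(ℓ−1)} absolutely continuous (a.e. derivative g^{(ℓ)}), E[(g^{(n)}(X))²] < ∞, and E|g^{(i)}(X)| < ∞ for i = n+1, …, m. Define S_{m,n}(g) = Σ_{i=1}^{m} (C(m,i) σ^{2i}/(m+n)_i)(E[g^{(i)}(X)])² + Σ_{i=1}^{n} (−1)^{i−1}(C(n,i) σ^{2i}/(m+n)_i) E[(g^{(i)}(X))²]. Then (−1)^n (Var[g(X)] − S_{m,n}(g)) ≥ 0, with equality if and only if g is a polynomial of degree at most m+n. -/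

import Mathlib

open MeasureTheory ProbabilityTheory Finset Filter

noncomputable section

/-- Falling factorial `(x)_k = x (x-1) ⋯ (x-k+1)`, with `(x)_0 = 1`. -/
def fall (x : ℝ) (k : ℕ) : ℝ := ∏ j ∈ Finset.range k, (x - j)

/-- Rising factorial `[x]_k = x (x+1) ⋯ (x+k-1)`, with `[x]_0 = 1`. -/
def rise (x : ℝ) (k : ℕ) : ℝ := ∏ j ∈ Finset.range k, (x + j)

/-- The product `∏_{j=a}^{a+len-1} (1 - j δ)` of `len` consecutive factors
(an empty product is `1`). -/
def pp (δ a : ℝ) (len : ℕ) : ℝ := ∏ j ∈ Finset.range len, (1 - (a + j) * δ)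

/-- The open real interval with (possibly infinite) endpoints `α ω : EReal`. -/
def erealIoo (α ω : EReal) : Set ℝ := {x : ℝ | α < (x : EReal) ∧ (x : EReal) < ω}

/-- `g` coincides on `J` with a polynomial of degree at most `d`. -/
def IsPolyOn (g : ℝ → ℝ) (J : Set ℝ) (d : ℕ) : Prop :=
  ∃ p : Polynomial ℝ, p.natDegree ≤ d ∧ ∀ x ∈ J, g x = p.eval x

/-- The quadratic `q(x) = δ x² + β x + γ` of a Pearson family. -/
def pq (δ β γ : ℝ) : ℝ → ℝ := fun x => δ * x ^ 2 + β * x + γ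

/-- `P` is the distribution of a random variable with density `f` (w.r.t. Lebesgue
measure) belonging to the integrated Pearson family `IP(μ; δ, β, γ)`:
`μ` is the (finite) mean of `P`, `|δ|+|β|+|γ| > 0`, and
`∫_{-∞}^x (μ - t) f(t) dt = q(x) f(x)` for all `x`. -/
def IsIntegratedPearson (P : Measure ℝ) (f : ℝ → ℝ) (μ δ β γ : ℝ) : Prop :=
  IsProbabilityMeasure P ∧
  (∀ x, 0 ≤ f x) ∧
  P = volume.withDensity (fun x => ENNReal.ofReal (f x)) ∧
  Integrable (fun x : ℝ => x) P ∧
  μ = ∫ x, x ∂P ∧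
  0 < |δ| + |β| + |γ| ∧
  ∀ x : ℝ, (∫ t in Set.Iic x, (μ - t) * f t) = pq δ β γ x * f x

/-- Membership in the class `H^{m,n}(X)` for the distribution `P` of `X` with Pearson
quadratic `q` and support `J`.  Here `gd k` plays the role of the `k`-th derivative
`g^{(k)}` of `g = gd 0` on `J`.  With `ℓ = max m n`:  `g ∈ C^{ℓ-1}(J)`
(encoded by `gd k` having derivative `gd (k+1)` at every point of `J` for `k+1 < ℓ`,
and `gd (ℓ-1)` continuous on `J`), `g^{(ℓ-1)}` is absolutely continuous on `J` with
a.e. derivative `g^{(ℓ)} = gd ℓ` (encoded by the fundamental theorem of calculus: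
`gd ℓ` is locally integrable and `gd (ℓ-1)` is its integral on every subinterval of `J`),
and the moment conditions `E[q(X)^n (g^{(n)}(X))²] < ∞` and
`E[q(X)^i |g^{(i)}(X)|] < ∞` for `n < i ≤ m` hold. -/
def MemH (P : Measure ℝ) (q : ℝ → ℝ) (J : Set ℝ) (m n : ℕ) (gd : ℕ → ℝ → ℝ) : Prop :=
  (∀ k, k + 1 < max m n → ∀ x ∈ J, HasDerivAt (gd k) (gd (k + 1) x) x) ∧
  (1 ≤ max m n → ContinuousOn (gd (max m n - 1)) J) ∧
  (1 ≤ max m n → ∀ a ∈ J, ∀ b ∈ J,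
    IntervalIntegrable (gd (max m n)) volume a b ∧
      gd (max m n - 1) b - gd (max m n - 1) a = ∫ t in a..b, gd (max m n) t) ∧
  Integrable (fun x => q x ^ n * (gd n x) ^ 2) P ∧
  ∀ i, n < i → i ≤ m → Integrable (fun x => q x ^ i * |gd i x|) P

/-- The variance bound `S_{m,n}(g)` of Theorem 2.1, for a Pearson distribution `P`
with quadratic `q` and parameter `δ`. -/
def Sbound (P : Measure ℝ) (δ : ℝ) (q : ℝ → ℝ) (m n : ℕ) (gd : ℕ → ℝ → ℝ) : ℝ :=
  (∑ i ∈ Finset.Icc 1 m,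
      ((m.choose i : ℝ) * pp δ ((m : ℝ) + i) n /
          (fall ((m : ℝ) + n) i * (∫ x, q x ^ i ∂P) * pp δ ((i : ℝ) - 1) i *
            pp δ (m : ℝ) n)) *
        (∫ x, q x ^ i * gd i x ∂P) ^ 2) +
    ∑ i ∈ Finset.Icc 1 n,
      (-1 : ℝ) ^ (i - 1) *
          ((n.choose i : ℝ) / (fall ((m : ℝ) + n) i * pp δ (m : ℝ) i)) *
        ∫ x, q x ^ i * (gd i x) ^ 2 ∂P

/-- The density of the normal distribution `N(μ, σ²)`. -/
def normalDensity (μ σ : ℝ) : ℝ → ℝ := fun x =>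
  (Real.sqrt (2 * Real.pi) * σ)⁻¹ * Real.exp (-(x - μ) ^ 2 / (2 * σ ^ 2))

/-- The bound `S_{m,n}(g)` specialized to the normal distribution `N(μ, σ²)`:
`S_{m,n}(g) = Σ_{i=1}^{m} (C(m,i) σ^{2i}/(m+n)_i)(E g^{(i)}(X))²
  + Σ_{i=1}^{n} (−1)^{i−1}(C(n,i) σ^{2i}/(m+n)_i) E (g^{(i)}(X))²`. -/
def SnormalBound (P : Measure ℝ) (σ : ℝ) (m n : ℕ) (gd : ℕ → ℝ → ℝ) : ℝ :=
  (∑ i ∈ Finset.Icc 1 m,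
      (m.choose i : ℝ) * σ ^ (2 * i) / fall ((m : ℝ) + n) i * (∫ x, gd i x ∂P) ^ 2) +
    ∑ i ∈ Finset.Icc 1 n,
      (-1 : ℝ) ^ (i - 1) * ((n.choose i : ℝ) * σ ^ (2 * i) / fall ((m : ℝ) + n) i) *
        ∫ x, (gd i x) ^ 2 ∂P


open Topology

/-- `h` is (locally) absolutely continuous with a.e. derivative `u`. -/
def ACd (h u : ℝ → ℝ) : Prop :=
  ∀ a b : ℝ, IntervalIntegrable u volume a b ∧ h b - h a = ∫ t in a..b, u t

lemma ACd.eq {h u : ℝ → ℝ} (H : ACd h u) (a : ℝ) : h = fun x => h a + ∫ t in a..x, u t := by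
  funext x; have := (H a x).2; linarith

lemma ACd.ac {h u : ℝ → ℝ} (H : ACd h u) (a b : ℝ) : AbsolutelyContinuousOnInterval h a b := by
  have h1 := (H a b).1.absolutelyContinuousOnInterval_intervalIntegral (c := a) (by simp)
  have h2 : AbsolutelyContinuousOnInterval (fun _ : ℝ => h a) a b :=
    (LipschitzWith.const (h a)).lipschitzOnWith.absolutelyContinuousOnInterval
  rw [H.eq a]
  exact h2.fun_add h1

lemma ACd.continuous {h u : ℝ → ℝ} (H : ACd h u) : Continuous h := by
  rw [H.eq 0]
  exact continuous_const.add (intervalIntegral.continuous_primitive (fun a b => (H a b).1) 0)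

lemma ACd.locInt {h u : ℝ → ℝ} (H : ACd h u) : LocallyIntegrable u volume := by
  intro x
  refine ⟨Set.Ioc (x-1) (x+1), Ioc_mem_nhds (by linarith) (by linarith), ?_⟩
  exact (intervalIntegrable_iff_integrableOn_Ioc_of_le (by linarith)).1 (H _ _).1

lemma ACd.aesm {h u : ℝ → ℝ} (H : ACd h u) : AEStronglyMeasurable u volume :=
  H.locInt.aestronglyMeasurable

lemma ACd.ae_hasDerivAt {h u : ℝ → ℝ} (H : ACd h u) : ∀ᵐ x, HasDerivAt h (u x) x := by
  filter_upwards [_root_.LocallyIntegrable.ae_hasDerivAt_integral H.locInt] with x hx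
  rw [H.eq 0]
  exact (hx 0).const_add _

lemma ACd.ibp {h u w z : ℝ → ℝ} (H : ACd h u) (W : ACd w z) (a b : ℝ) :
    ∫ x in a..b, (u x * w x + h x * z x) = h b * w b - h a * w a := by
  rw [← (H.ac a b).integral_deriv_mul_eq_sub (W.ac a b)]
  apply intervalIntegral.integral_congr_ae
  filter_upwards [H.ae_hasDerivAt, W.ae_hasDerivAt] with x h1 h2 _
  rw [h1.deriv, h2.deriv]

lemma ACd.of_hasDerivAt {h u : ℝ → ℝ} (H : ∀ x, HasDerivAt h (u x) x) (hu : Continuous u) :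
    ACd h u := by
  intro a b
  refine ⟨hu.intervalIntegrable a b, ?_⟩
  rw [intervalIntegral.integral_eq_sub_of_hasDerivAt (fun x _ => H x) (hu.intervalIntegrable a b)]

lemma ACd.primitive {u : ℝ → ℝ} (hu : ∀ a b, IntervalIntegrable u volume a b) (c k : ℝ) :
    ACd (fun x => k + ∫ t in c..x, u t) u := by
  intro a b
  refine ⟨hu a b, ?_⟩
  have := intervalIntegral.integral_interval_sub_left (hu c b) (hu c a)
  simp only; linarith

lemma ACd.comp_neg {h u : ℝ → ℝ} (H : ACd h u) (c : ℝ) :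
    ACd (fun t => h (c - t)) (fun t => - u (c - t)) := by
  intro a b
  constructor
  · have := ((H (c - a) (c - b)).1.comp_sub_left c)
    simp only [sub_sub_cancel] at this
    exact this.neg
  · rw [intervalIntegral.integral_neg, intervalIntegral.integral_comp_sub_left (fun t => u t) c,
      ← (H _ _).2]
    ring

lemma ACd.comp_add {h u : ℝ → ℝ} (H : ACd h u) (c : ℝ) :
    ACd (fun t => h (c + t)) (fun t => u (c + t)) := by
  intro a b
  constructor
  · have := ((H (c + a) (c + b)).1.comp_add_left c)
    simpa using this
  · rw [intervalIntegral.integral_comp_add_left (fun t => u t) c, ← (H _ _).2]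

lemma one_sided {h u : ℝ → ℝ} (H : ACd h u) {c : ℝ} (hc : 0 < c) (j : ℕ)
    (hu : IntegrableOn (fun t => t ^ j * Real.exp (-c * t ^ 2) * u t) (Set.Ioi 0)) :
    IntegrableOn (fun t => t ^ (j + 1) * Real.exp (-c * t ^ 2) * h t) (Set.Ioi 0) := by
  set R : ℝ := j / c + 1 with hR
  have hR1 : 1 ≤ R := by rw [hR]; have : 0 ≤ (j : ℝ) / c := by positivity
                         linarith
  have hcR : (j : ℝ) ≤ c * R ^ 2 := by
    have : c * R = j + c := by rw [hR]; field_simp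
    nlinarith
  have hcont : Continuous (fun t => t ^ (j + 1) * Real.exp (-c * t ^ 2) * h t) := by
    have := H.continuous
    fun_prop
  have habs : ∀ a b, IntervalIntegrable (fun t => |u t|) volume a b := fun a b => (H a b).1.abs
  set V : ℝ → ℝ := fun x => |h R| + ∫ t in R..x, |u t| with hV
  have HV : ACd V (fun t => |u t|) := ACd.primitive habs R _
  have hhV : ∀ x, R ≤ x → |h x| ≤ V x := by
    intro x hx
    have h1 := (H R x).2
    have h2 : |∫ t in R..x, u t| ≤ ∫ t in R..x, |u t| :=
      intervalIntegral.abs_integral_le_integral_abs hx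
    have : h x = h R + ∫ t in R..x, u t := by linarith
    rw [this]
    exact (abs_add_le _ _).trans (by simp only [hV]; linarith)
  set W : ℝ → ℝ := fun x => x ^ j * Real.exp (-c * x ^ 2) / c with hW
  set Z : ℝ → ℝ := fun x => (j * x ^ (j - 1) - 2 * c * x ^ (j + 1)) * Real.exp (-c * x ^ 2) / c with hZ
  have HW : ACd W Z := by
    apply ACd.of_hasDerivAt
    · intro x
      have h1 : HasDerivAt (fun x : ℝ => -c * x ^ 2) (-c * (2 * x)) x := by
        simpa using (hasDerivAt_pow 2 x).const_mul (-c)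
      have h2 := ((hasDerivAt_pow j x).mul h1.exp).div_const c
      refine h2.congr_deriv ?_
      simp only [hZ]
      rw [pow_succ]; ring
    · fun_prop
  have hZle : ∀ x, R ≤ x → x ^ (j + 1) * Real.exp (-c * x ^ 2) ≤ - Z x := by
    intro x hx
    have hx0 : 0 < x := by linarith
    have key : (j : ℝ) * x ^ (j - 1) ≤ c * x ^ (j + 1) := by
      rcases j with _ | j
      · simp; positivity
      · have h3 : ((j + 1 : ℕ) : ℝ) ≤ c * x ^ 2 := hcR.trans (by gcongr)
        calc ((j + 1 : ℕ) : ℝ) * x ^ (j + 1 - 1) ≤ (c * x ^ 2) * x ^ j := by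
              simp only [Nat.add_sub_cancel]; gcongr
          _ = _ := by ring
    have : - Z x = ((2 * c * x ^ (j + 1) - j * x ^ (j - 1)) / c) * Real.exp (-c * x ^ 2) := by
      simp only [hZ]; ring
    rw [this]
    gcongr
    rw [le_div_iff₀ hc]; nlinarith
  set I : ℝ := V R * W R + ∫ t in Set.Ioi 0, |t ^ j * Real.exp (-c * t ^ 2) * u t| / c with hI
  have hIoi : IntegrableOn (fun t => t ^ (j + 1) * Real.exp (-c * t ^ 2) * h t) (Set.Ioi R) := by
    refine integrableOn_Ioi_of_intervalIntegral_norm_bounded (l := atTop) (b := id) I R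
      (fun i => hcont.integrableOn_Ioc) tendsto_id ?_
    filter_upwards [eventually_ge_atTop R] with T hT
    simp only [id]
    have cZ : Continuous Z := by fun_prop
    have cW : Continuous W := HW.continuous
    have cV : Continuous V := HV.continuous
    have e1 : ∫ x in R..T, ‖x ^ (j + 1) * Real.exp (-c * x ^ 2) * h x‖ ≤
        ∫ x in R..T, - (V x * Z x) := by
      apply intervalIntegral.integral_mono_on hT (hcont.norm.intervalIntegrable _ _)
        ((by fun_prop : Continuous fun x => -(V x * Z x)).intervalIntegrable _ _)
      intro x hx
      have hx0 : 0 < x := by linarith [hx.1]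
      rw [Real.norm_eq_abs, abs_mul, abs_of_nonneg (by positivity)]
      have a1 := hZle x hx.1
      have a2 := hhV x hx.1
      have a3 : 0 ≤ x ^ (j + 1) * Real.exp (-c * x ^ 2) := by positivity
      have a4 := a3.trans a1
      calc _ ≤ (- Z x) * V x := by gcongr
        _ = _ := by ring
    have e2 := HV.ibp HW R T
    have i1 : IntervalIntegrable (fun x => |u x| * W x) volume R T :=
      (habs R T).mul_continuousOn cW.continuousOn
    have i2 : IntervalIntegrable (fun x => V x * Z x) volume R T :=
      (cV.mul cZ).intervalIntegrable _ _
    rw [intervalIntegral.integral_add i1 i2] at e2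
    rw [intervalIntegral.integral_neg] at e1
    have e3 : 0 ≤ V T * W T := by
      have : 0 ≤ V T := (abs_nonneg _).trans (hhV T hT)
      have : 0 ≤ W T := by
        have : 0 < T := by linarith
        simp only [hW]; positivity
      positivity
    have e4 : ∫ x in R..T, |u x| * W x ≤
        ∫ t in Set.Ioi 0, |t ^ j * Real.exp (-c * t ^ 2) * u t| / c := by
      rw [intervalIntegral.integral_of_le hT]
      have : ∫ x in Set.Ioc R T, |u x| * W x =
          ∫ t in Set.Ioc R T, |t ^ j * Real.exp (-c * t ^ 2) * u t| / c := by
        apply setIntegral_congr_fun measurableSet_Ioc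
        intro x hx
        have hx0 : 0 < x := by linarith [hx.1]
        simp only [hW]
        rw [abs_mul, abs_of_nonneg (by positivity : 0 ≤ x ^ j * Real.exp (-c * x ^ 2))]
        ring
      rw [this]
      apply setIntegral_mono_set (hu.abs.div_const c)
      · exact ae_of_all _ fun x => by simp only [Pi.zero_apply]; positivity
      · refine LE.le.eventuallyLE ?_
        intro x hx
        have := hx.1
        simp only [Set.mem_Ioi]; linarith
    simp only [hI]
    linarith
  have : Set.Ioi (0 : ℝ) = Set.Ioc 0 R ∪ Set.Ioi R :=
    (Set.Ioc_union_Ioi_eq_Ioi (by linarith)).symm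
  rw [this]
  exact hcont.integrableOn_Ioc.union hIoi

open scoped NNReal

lemma int_of_halves {F : ℝ → ℝ} {c : ℝ} (h1 : IntegrableOn (fun t => F (c + t)) (Set.Ioi 0))
    (h2 : IntegrableOn (fun t => F (c - t)) (Set.Ioi 0)) : Integrable F := by
  have e1 := (measurePreserving_add_left volume c).integrableOn_comp_preimage
    (measurableEmbedding_addLeft c) (f := F) (s := Set.Ioi c)
  have e2 := (Measure.measurePreserving_sub_left volume c).integrableOn_comp_preimage
    (measurableEmbedding_subLeft c) (f := F) (s := Set.Iio c)
  have s1 : (fun x : ℝ => c + x) ⁻¹' Set.Ioi c = Set.Ioi 0 := by ext x; simp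
  have s2 : (fun x : ℝ => c - x) ⁻¹' Set.Iio c = Set.Ioi 0 := by ext x; simp
  rw [s1] at e1
  rw [s2] at e2
  have i1 := e1.1 h1
  have i2 := e2.1 h2
  rw [← integrableOn_univ, ← Set.Iic_union_Ioi (a := c)]
  exact ((integrableOn_Iic_iff_integrableOn_Iio).2 i2).union i1

lemma integrable_gauss_iff {μ : ℝ} {v : ℝ≥0} (hv : v ≠ 0) {f : ℝ → ℝ} :
    Integrable f (gaussianReal μ v) ↔ Integrable (fun x => gaussianPDFReal μ v x * f x) := by
  rw [gaussianReal_of_var_ne_zero _ hv, integrable_withDensity_iff_integrable_smul'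
    (measurable_gaussianPDF _ _) (ae_of_all _ fun _ => gaussianPDF_lt_top)]
  simp [toReal_gaussianPDF]

lemma integral_gauss {μ : ℝ} {v : ℝ≥0} (hv : v ≠ 0) (f : ℝ → ℝ) :
    ∫ x, f x ∂(gaussianReal μ v) = ∫ x, gaussianPDFReal μ v x * f x := by
  rw [integral_gaussianReal_eq_integral_smul hv]; rfl

lemma pdf_eq {μ : ℝ} {v : ℝ≥0} (x : ℝ) : gaussianPDFReal μ v x =
    (√(2 * Real.pi * v))⁻¹ * Real.exp (-(2 * (v : ℝ))⁻¹ * (x - μ) ^ 2) := by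
  rw [gaussianPDFReal]; congr 2; rw [div_eq_inv_mul]; ring

lemma core_step {μ : ℝ} {v : ℝ≥0} (hv : v ≠ 0) {h u : ℝ → ℝ} (H : ACd h u) (j : ℕ)
    (hu : Integrable (fun x => (x - μ) ^ j * u x) (gaussianReal μ v)) :
    Integrable (fun x => (x - μ) ^ (j + 1) * h x) (gaussianReal μ v) := by
  have hv' : (0 : ℝ) < v := by positivity
  have hc : 0 < (2 * (v : ℝ))⁻¹ := by positivity
  have hK : (√(2 * Real.pi * v))⁻¹ ≠ 0 := by positivity
  rw [integrable_gauss_iff hv] at hu ⊢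
  simp only [pdf_eq] at hu ⊢
  set c := (2 * (v : ℝ))⁻¹
  set K := (√(2 * Real.pi * v))⁻¹
  apply int_of_halves (c := μ)
  · have A := one_sided (H.comp_add μ) hc j (by
      have := ((hu.comp_add_left μ).const_mul K⁻¹).integrableOn (s := Set.Ioi 0)
      refine this.congr (ae_of_all _ fun t => ?_)
      simp only [add_sub_cancel_left]
      field_simp)
    refine (A.const_mul K).congr (ae_of_all _ fun t => ?_)
    simp only [add_sub_cancel_left]
    ring
  · have A := one_sided (H.comp_neg μ) hc j (by
      have := ((hu.comp_sub_left μ).const_mul ((-1) ^ (j + 1) * K⁻¹)).integrableOn (s := Set.Ioi 0)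
      refine this.congr (ae_of_all _ fun t => ?_)
      have e : μ - t - μ = (-1) * t := by ring
      simp only [e, mul_pow]
      have e2 : ((-1 : ℝ) ^ j) * (-1) ^ j = 1 := by rw [← mul_pow]; simp
      field_simp
      rw [pow_succ]
      linear_combination (-t ^ j * u (μ - t)) * e2)
    refine (A.const_mul ((-1) ^ (j + 1) * K)).congr (ae_of_all _ fun t => ?_)
    have e : μ - t - μ = (-1) * t := by ring
    simp only [e, mul_pow]
    ring

/-- all the monomials up to degree `k` are integrable against `h`. -/
def Wk (μ : ℝ) (v : ℝ≥0) (k : ℕ) (h : ℝ → ℝ) : Prop :=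
  ∀ j ≤ k, Integrable (fun x => (x - μ) ^ j * h x) (gaussianReal μ v)

lemma Wk.step {μ : ℝ} {v : ℝ≥0} (hv : v ≠ 0) {h u : ℝ → ℝ} (H : ACd h u) {k : ℕ}
    (hu : Wk μ v k u) : Wk μ v (k + 1) h := by
  intro j hj
  rcases j with _ | j
  · have h1 := core_step hv H 0 (hu 0 (Nat.zero_le _))
    obtain ⟨C, hC⟩ := (isCompact_Icc (a := μ - 1) (b := μ + 1)).exists_bound_of_continuousOn
      H.continuous.continuousOn
    have : Integrable (fun x => |C| + |(x - μ) ^ (0 + 1) * h x|) (gaussianReal μ v) :=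
      (integrable_const _).add h1.abs
    refine this.mono' (by have := H.continuous; fun_prop) (ae_of_all _ fun x => ?_)
    simp only [pow_zero, one_mul, zero_add, pow_one]
    by_cases hx : x ∈ Set.Icc (μ - 1) (μ + 1)
    · have := hC x hx
      have := le_abs_self C
      have := abs_nonneg ((x - μ) * h x)
      linarith
    · have h2 : 1 ≤ |x - μ| := by
        by_contra h3
        push Not at h3
        rw [abs_lt] at h3
        exact hx ⟨by linarith, by linarith⟩
      rw [abs_mul, Real.norm_eq_abs]
      have := abs_nonneg C
      nlinarith [abs_nonneg (h x)]
  · exact core_step hv H j (hu j (by omega))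

lemma Wk.poly {μ : ℝ} {v : ℝ≥0} {h : ℝ → ℝ} {k : ℕ} (hh : Wk μ v k h) (q : Polynomial ℝ)
    (hq : q.natDegree ≤ k) : Integrable (fun x => q.eval x * h x) (gaussianReal μ v) := by
  have : (fun x => q.eval x * h x) = fun x => ∑ i ∈ Finset.range (k + 1),
      (Polynomial.taylor μ q).coeff i * ((x - μ) ^ i * h x) := by
    funext x
    rw [← Polynomial.taylor_eval_sub (r := μ) (f := q) x, Polynomial.eval_eq_sum_range' (n := k + 1)
      (by rw [Polynomial.natDegree_taylor]; omega), Finset.sum_mul]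
    exact Finset.sum_congr rfl fun i _ => by ring
  rw [this]
  apply integrable_finsetSum
  intro i hi
  exact (hh i (by simp at hi; omega)).const_mul _

lemma cs_interval {u : ℝ → ℝ} {a b : ℝ} (hu : IntervalIntegrable u volume a b)
    (hu2 : IntervalIntegrable (fun x => u x ^ 2) volume a b) :
    (∫ x in a..b, u x) ^ 2 ≤ (b - a) * ∫ x in a..b, u x ^ 2 := by
  wlog hab : a ≤ b generalizing a b
  · have := this hu.symm hu2.symm (by linarith)
    rw [intervalIntegral.integral_symm b a, intervalIntegral.integral_symm (f := fun x => u x ^ 2) b a]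
    nlinarith
  rcases hab.eq_or_lt with rfl | hab'
  · simp
  set m := (∫ x in a..b, u x) / (b - a) with hm
  have h0 : 0 ≤ ∫ x in a..b, (u x - m) ^ 2 :=
    intervalIntegral.integral_nonneg hab fun x _ => sq_nonneg _
  have e : ∫ x in a..b, (u x - m) ^ 2 =
      (∫ x in a..b, u x ^ 2) - 2 * m * (∫ x in a..b, u x) + m ^ 2 * (b - a) := by
    have : (fun x => (u x - m) ^ 2) = fun x => (u x ^ 2 - 2 * m * u x) + m ^ 2 := by
      funext x; ring
    rw [this, intervalIntegral.integral_add (hu2.sub (hu.const_mul _)) (by simp),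
      intervalIntegral.integral_sub hu2 (hu.const_mul _), intervalIntegral.integral_const_mul,
      intervalIntegral.integral_const]
    simp; ring
  have hb : 0 < b - a := by linarith
  have hI : (∫ x in a..b, u x) = m * (b - a) := by rw [hm]; field_simp
  rw [e, hI] at h0
  rw [hI]
  nlinarith

lemma continuous_pdf {μ : ℝ} {v : ℝ≥0} : Continuous (gaussianPDFReal μ v) := by
  have : gaussianPDFReal μ v = fun x => (√(2 * Real.pi * v))⁻¹ * Real.exp (-(2 * (v : ℝ))⁻¹ * (x - μ) ^ 2) :=
    funext fun x => pdf_eq x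
  rw [this]; fun_prop

lemma L2_step {μ : ℝ} {v : ℝ≥0} (hv : v ≠ 0) {h u : ℝ → ℝ} (H : ACd h u)
    (hu : Integrable (fun x => u x ^ 2) (gaussianReal μ v)) :
    Integrable (fun x => h x ^ 2) (gaussianReal μ v) := by
  have hu' := (integrable_gauss_iff hv).1 hu
  have hloc : ∀ a b, IntervalIntegrable (fun x => u x ^ 2) volume a b := by
    intro a b
    have h1 : IntervalIntegrable (fun x => gaussianPDFReal μ v x * u x ^ 2) volume a b :=
      hu'.intervalIntegrable
    have h2 := h1.continuousOn_mul (f := fun x => gaussianPDFReal μ v x * u x ^ 2) (g := fun x => (gaussianPDFReal μ v x)⁻¹)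
      (continuous_pdf.inv₀ fun x => (gaussianPDFReal_pos μ v x hv).ne').continuousOn
    refine h2.congr (fun x _ => ?_)
    have := (gaussianPDFReal_pos μ v x hv).ne'
    field_simp
  have A := core_step hv (ACd.primitive hloc μ 0) 0 (by simpa using hu)
  have B : Integrable (fun x => 2 * |(x - μ) ^ (0 + 1) * (0 + ∫ t in μ..x, u t ^ 2)| + 2 * h μ ^ 2)
      (gaussianReal μ v) := (A.abs.const_mul 2).add (integrable_const _)
  refine B.mono' (by have := H.continuous; fun_prop) (ae_of_all _ fun x => ?_)
  have h1 := (H μ x).2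
  have h2 := cs_interval (H μ x).1 (hloc μ x)
  rw [← h1] at h2
  have h3 := le_abs_self ((x - μ) * ∫ t in μ..x, u t ^ 2)
  simp only [zero_add, pow_one, Real.norm_eq_abs, abs_of_nonneg (sq_nonneg (h x))]
  nlinarith [sq_nonneg (h x - 2 * h μ)]

lemma ibp_line {h u w z : ℝ → ℝ} (H : ACd h u) (W : ACd w z)
    (i1 : Integrable (fun x => u x * w x + h x * z x)) (i2 : Integrable (fun x => h x * w x)) :
    ∫ x, (u x * w x + h x * z x) = 0 := by
  have t1 := intervalIntegral_tendsto_integral i1 tendsto_neg_atTop_atBot tendsto_id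
  simp only [id] at t1
  simp_rw [H.ibp W] at t1
  refine IntegrableAtFilter.eq_zero_of_tendsto (μ := volume) ?_ ?_ t1
  · have : Integrable (fun x => h x * w x - h (-x) * w (-x)) := i2.sub i2.comp_neg
    exact this.integrableAtFilter _
  · intro s hs
    obtain ⟨b, hb⟩ := mem_atTop_sets.1 hs
    apply measure_mono_top (s₁ := Set.Ici b) (fun x hx => hb x hx)
    simp

lemma hasDerivAt_pdf {μ : ℝ} {v : ℝ≥0} (hv : v ≠ 0) (x : ℝ) :
    HasDerivAt (gaussianPDFReal μ v) (-(v : ℝ)⁻¹ * (x - μ) * gaussianPDFReal μ v x) x := by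
  have : gaussianPDFReal μ v = fun x => (√(2 * Real.pi * v))⁻¹ * Real.exp (-(2 * (v : ℝ))⁻¹ * (x - μ) ^ 2) :=
    funext fun x => pdf_eq x
  rw [this]
  have h1 : HasDerivAt (fun x : ℝ => -(2 * (v : ℝ))⁻¹ * (x - μ) ^ 2)
      (-(2 * (v : ℝ))⁻¹ * (2 * (x - μ))) x := by
    simpa using (((hasDerivAt_id x).sub_const μ).pow 2).const_mul (-(2 * (v : ℝ))⁻¹)
  refine (h1.exp.const_mul _).congr_deriv ?_
  have : (v : ℝ) ≠ 0 := by exact_mod_cast hv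
  field_simp

/-- the raising operator on polynomials -/
def raise (μ : ℝ) (v : ℝ≥0) (q : Polynomial ℝ) : Polynomial ℝ :=
  Polynomial.C (v : ℝ)⁻¹ * (Polynomial.X - Polynomial.C μ) * q - Polynomial.derivative q

lemma natDegree_raise {μ : ℝ} {v : ℝ≥0} {q : Polynomial ℝ} {k : ℕ} (hq : q.natDegree ≤ k) :
    (raise μ v q).natDegree ≤ k + 1 := by
  unfold raise
  refine (Polynomial.natDegree_sub_le _ _).trans (max_le ?_ ?_)
  · rw [mul_assoc]
    refine (Polynomial.natDegree_C_mul_le _ _).trans (Polynomial.natDegree_mul_le.trans ?_)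
    rw [Polynomial.natDegree_X_sub_C]; omega
  · exact (Polynomial.natDegree_derivative_le q).trans (by omega)

lemma ibp_gauss {μ : ℝ} {v : ℝ≥0} (hv : v ≠ 0) {h u : ℝ → ℝ} (H : ACd h u) {k : ℕ}
    (hu : Wk μ v k u) (q : Polynomial ℝ) (hq : q.natDegree ≤ k) :
    ∫ x, q.eval x * u x ∂(gaussianReal μ v) =
      ∫ x, (raise μ v q).eval x * h x ∂(gaussianReal μ v) := by
  have hh := Wk.step hv H hu
  have i1 := hu.poly q hq
  have i2 := hh.poly q (by omega)
  have i3 := hh.poly (raise μ v q) (natDegree_raise hq)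
  have W : ACd (fun x => gaussianPDFReal μ v x * q.eval x)
      (fun x => - (gaussianPDFReal μ v x * (raise μ v q).eval x)) := by
    apply ACd.of_hasDerivAt
    · intro x
      refine ((hasDerivAt_pdf hv x).mul (q.hasDerivAt x)).congr_deriv ?_
      simp [raise]; ring
    · have := continuous_pdf (μ := μ) (v := v)
      fun_prop
  rw [integrable_gauss_iff hv] at i1 i2 i3
  have e := ibp_line H W ((i1.sub i3).congr (ae_of_all _ fun x => by simp only [Pi.sub_apply]; ring))
    (i2.congr (ae_of_all _ fun x => by ring))
  have e' : ∫ x, (gaussianPDFReal μ v x * (q.eval x * u x) -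
      gaussianPDFReal μ v x * ((raise μ v q).eval x * h x)) = 0 := by
    rw [← e]; exact integral_congr_ae (ae_of_all _ fun x => by simp only; ring)
  rw [integral_sub i1 i3] at e'
  rw [integral_gauss hv, integral_gauss hv]
  linarith

open scoped NNReal ENNReal

/-- Hermite polynomials adapted to `N(μ, v)`. -/
def hp (μ : ℝ) (v : ℝ≥0) : ℕ → Polynomial ℝ
  | 0 => 1
  | k + 1 => raise μ v (hp μ v k)

/-- Hermite coefficients. -/
def cf (μ : ℝ) (v : ℝ≥0) (k : ℕ) (h : ℝ → ℝ) : ℝ :=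
  ∫ x, (hp μ v k).eval x * h x ∂(gaussianReal μ v)

lemma natDegree_hp (μ : ℝ) (v : ℝ≥0) (k : ℕ) : (hp μ v k).natDegree ≤ k := by
  induction k with
  | zero => simp [hp]
  | succ k ih => exact natDegree_raise ih

lemma cf_step {μ : ℝ} {v : ℝ≥0} (hv : v ≠ 0) {h u : ℝ → ℝ} (H : ACd h u) {k : ℕ}
    (hu : Wk μ v k u) : cf μ v k u = cf μ v (k + 1) h :=
  ibp_gauss hv H hu _ (natDegree_hp μ v k)

lemma integrable_poly (μ : ℝ) (v : ℝ≥0) (q : Polynomial ℝ) :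
    Integrable (fun x => q.eval x) (gaussianReal μ v) := by
  simp_rw [Polynomial.eval_eq_sum_range]
  apply integrable_finsetSum
  intro i _
  apply Integrable.const_mul
  have := (memLp_id_gaussianReal' (μ := μ) (v := v) (i : ℝ≥0∞) (by simp)).integrable_norm_pow'
  refine this.mono' (by fun_prop) (ae_of_all _ fun x => by simp)

lemma memLp_poly (μ : ℝ) (v : ℝ≥0) (q : Polynomial ℝ) :
    MemLp (fun x => q.eval x) 2 (gaussianReal μ v) := by
  rw [memLp_two_iff_integrable_sq (by fun_prop)]
  exact (integrable_poly μ v (q ^ 2)).congr (ae_of_all _ fun x => by simp)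

lemma Wk_of_memLp {μ : ℝ} {v : ℝ≥0} {f : ℝ → ℝ} (hf : MemLp f 2 (gaussianReal μ v)) (k : ℕ) :
    Wk μ v k f := by
  intro j _
  have := (memLp_poly μ v ((Polynomial.X - Polynomial.C μ) ^ j)).integrable_mul hf
  refine this.congr (ae_of_all _ fun x => by simp)

lemma int_poly_mul {μ : ℝ} {v : ℝ≥0} {f : ℝ → ℝ} (hf : MemLp f 2 (gaussianReal μ v))
    (q : Polynomial ℝ) : Integrable (fun x => q.eval x * f x) (gaussianReal μ v) :=
  (memLp_poly μ v q).integrable_mul hf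

lemma ACd_poly (p : Polynomial ℝ) :
    ACd (fun x => p.eval x) (fun x => (Polynomial.derivative p).eval x) :=
  ACd.of_hasDerivAt (fun x => p.hasDerivAt x) (by fun_prop)

lemma cf_poly_succ {μ : ℝ} {v : ℝ≥0} (hv : v ≠ 0) (k : ℕ) (p : Polynomial ℝ) :
    cf μ v (k + 1) (fun x => p.eval x) =
      cf μ v k (fun x => (Polynomial.derivative p).eval x) :=
  (cf_step hv (ACd_poly p) (Wk_of_memLp (memLp_poly μ v _) k)).symm

lemma cf_poly_zero {μ : ℝ} {v : ℝ≥0} (hv : v ≠ 0) (k : ℕ) (p : Polynomial ℝ)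
    (hp' : p.natDegree < k) : cf μ v k (fun x => p.eval x) = 0 := by
  induction k generalizing p with
  | zero => omega
  | succ k ih =>
    rw [cf_poly_succ hv]
    rcases Nat.eq_zero_or_pos p.natDegree with h0 | h0
    · rw [Polynomial.eq_C_of_natDegree_eq_zero h0]
      simp [cf]
    · exact ih _ (lt_of_lt_of_le (Polynomial.natDegree_derivative_lt (by omega)) (by omega))

lemma derivative_raise (μ : ℝ) (v : ℝ≥0) (q : Polynomial ℝ) :
    Polynomial.derivative (raise μ v q) =
      Polynomial.C (v : ℝ)⁻¹ * q + raise μ v (Polynomial.derivative q) := by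
  simp [raise, Polynomial.derivative_mul]; ring

lemma raise_C_mul (μ : ℝ) (v : ℝ≥0) (a : ℝ) (q : Polynomial ℝ) :
    raise μ v (Polynomial.C a * q) = Polynomial.C a * raise μ v q := by
  simp [raise]; ring

lemma derivative_hp (μ : ℝ) (v : ℝ≥0) (k : ℕ) :
    Polynomial.derivative (hp μ v (k + 1)) =
      Polynomial.C ((k + 1) * (v : ℝ)⁻¹) * hp μ v k := by
  induction k with
  | zero =>
    change Polynomial.derivative (raise μ v (hp μ v 0)) = _
    rw [derivative_raise]; simp [hp, raise]
  | succ k ih =>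
    change Polynomial.derivative (raise μ v (hp μ v (k + 1))) = _
    rw [derivative_raise, ih, raise_C_mul, ← hp.eq_2]
    push_cast
    simp only [map_mul, map_add, map_one]
    ring

lemma cf_comm (μ : ℝ) (v : ℝ≥0) (j k : ℕ) :
    cf μ v k (fun x => (hp μ v j).eval x) = cf μ v j (fun x => (hp μ v k).eval x) := by
  unfold cf; congr 1; funext x; ring

lemma cf_hp {μ : ℝ} {v : ℝ≥0} (hv : v ≠ 0) (k j : ℕ) :
    cf μ v k (fun x => (hp μ v j).eval x) = if k = j then (k.factorial : ℝ) / (v : ℝ) ^ k else 0 := by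
  induction k generalizing j with
  | zero =>
    rcases j with _ | j
    · simp [cf, hp]
    · rw [cf_comm, cf_poly_zero hv]
      · simp
      · simp [hp]
  | succ k ih =>
    rcases j with _ | j
    · rw [cf_poly_zero hv]
      · simp
      · simp [hp]
    · rw [cf_poly_succ hv, derivative_hp]
      have : cf μ v k (fun x => (Polynomial.C ((j + 1) * (v : ℝ)⁻¹) * hp μ v j).eval x) =
          ((j + 1) * (v : ℝ)⁻¹) * cf μ v k (fun x => (hp μ v j).eval x) := by
        unfold cf
        rw [← integral_const_mul]
        congr 1; funext x
        simp; ring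
      rw [this, ih]
      by_cases h : k = j
      · subst h
        simp [Nat.factorial_succ, pow_succ]; field_simp
      · simp [h]

lemma X_mul_hp {μ : ℝ} {v : ℝ≥0} (hv : v ≠ 0) (k : ℕ) :
    Polynomial.X * hp μ v (k + 1) = Polynomial.C (v : ℝ) * hp μ v (k + 2) +
      Polynomial.C (k + 1 : ℝ) * hp μ v k + Polynomial.C μ * hp μ v (k + 1) := by
  have h1 : (v : ℝ) ≠ 0 := by exact_mod_cast hv
  rw [hp.eq_2 μ v (k + 1), raise, derivative_hp]
  have e : Polynomial.C (v : ℝ) * Polynomial.C (v : ℝ)⁻¹ = 1 := by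
    rw [← Polynomial.C_mul, mul_inv_cancel₀ h1, Polynomial.C_1]
  rw [Polynomial.C_mul]
  linear_combination (-(Polynomial.X - Polynomial.C μ) * hp μ v (k + 1) +
    Polynomial.C (k + 1 : ℝ) * hp μ v k) * e

lemma X_mul_hp_zero {μ : ℝ} {v : ℝ≥0} (hv : v ≠ 0) :
    Polynomial.X * hp μ v 0 = Polynomial.C (v : ℝ) * hp μ v 1 + Polynomial.C μ * hp μ v 0 := by
  have h1 : (v : ℝ) ≠ 0 := by exact_mod_cast hv
  have e : Polynomial.C (v : ℝ) * Polynomial.C (v : ℝ)⁻¹ = 1 := by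
    rw [← Polynomial.C_mul, mul_inv_cancel₀ h1, Polynomial.C_1]
  simp only [hp, raise, Polynomial.derivative_one]
  linear_combination (-(Polynomial.X - Polynomial.C μ)) * e

lemma moments_zero {μ : ℝ} {v : ℝ≥0} (hv : v ≠ 0) {f : ℝ → ℝ}
    (hf : MemLp f 2 (gaussianReal μ v)) (h0 : ∀ k, cf μ v k f = 0) (j k : ℕ) :
    ∫ x, (Polynomial.X ^ j * hp μ v k).eval x * f x ∂(gaussianReal μ v) = 0 := by
  induction j generalizing k with
  | zero => simpa [cf] using h0 k
  | succ j ih =>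
    have lin : ∀ (p q r : Polynomial ℝ) (a b c : ℝ),
        ∫ x, (Polynomial.C a * p + Polynomial.C b * q + Polynomial.C c * r).eval x * f x
          ∂(gaussianReal μ v) = a * ∫ x, p.eval x * f x ∂(gaussianReal μ v) +
          b * ∫ x, q.eval x * f x ∂(gaussianReal μ v) +
          c * ∫ x, r.eval x * f x ∂(gaussianReal μ v) := by
      intro p q r a b c
      have ip := (int_poly_mul hf p).const_mul a
      have iq := (int_poly_mul hf q).const_mul b
      have ir := (int_poly_mul hf r).const_mul c
      have ipq : Integrable (fun x => a * (p.eval x * f x) + b * (q.eval x * f x))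
          (gaussianReal μ v) := ip.add iq
      rw [← integral_const_mul, ← integral_const_mul, ← integral_const_mul,
        ← integral_add ip iq, ← integral_add ipq ir]
      congr 1; funext x; simp; ring
    rcases k with _ | k
    · have : Polynomial.X ^ (j + 1) * hp μ v 0 = Polynomial.C (v : ℝ) * (Polynomial.X ^ j * hp μ v 1) +
          Polynomial.C μ * (Polynomial.X ^ j * hp μ v 0) +
          Polynomial.C 0 * (Polynomial.X ^ j * hp μ v 0) := by
        rw [Polynomial.C_0]
        linear_combination Polynomial.X ^ j * X_mul_hp_zero (μ := μ) hv
      rw [this, lin, ih, ih]; ring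
    · have : Polynomial.X ^ (j + 1) * hp μ v (k + 1) =
          Polynomial.C (v : ℝ) * (Polynomial.X ^ j * hp μ v (k + 2)) +
          Polynomial.C (k + 1 : ℝ) * (Polynomial.X ^ j * hp μ v k) +
          Polynomial.C μ * (Polynomial.X ^ j * hp μ v (k + 1)) := by
        linear_combination Polynomial.X ^ j * X_mul_hp (μ := μ) hv k
      rw [this, lin, ih, ih, ih]; ring

lemma charFun_zero {μ : ℝ} {v : ℝ≥0} {f : ℝ → ℝ}
    (hf : MemLp f 2 (gaussianReal μ v))
    (h0 : ∀ j : ℕ, ∫ x, x ^ j * f x ∂(gaussianReal μ v) = 0) (t : ℝ) :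
    ∫ x, (f x : ℂ) * Complex.exp (t * x * Complex.I) ∂(gaussianReal μ v) = 0 := by
  have hexp : MemLp (fun x => Real.exp (|t| * |x|)) 2 (gaussianReal μ v) := by
    rw [memLp_two_iff_integrable_sq (by fun_prop)]
    have := integrable_exp_mul_abs (μ := gaussianReal μ v) (X := fun x => x) (t := 2 * |t|)
      (integrable_exp_mul_gaussianReal _) (integrable_exp_mul_gaussianReal _)
    refine this.congr (ae_of_all _ fun x => ?_)
    simp only
    rw [← Real.exp_nat_mul]; congr 1; push_cast; ring
  have hs : ∀ x : ℝ, HasSum (fun n : ℕ => (|t| * |x|) ^ n / n.factorial * |f x|)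
      (Real.exp (|t| * |x|) * |f x|) := by
    intro x
    apply HasSum.mul_right
    rw [Real.exp_eq_exp_ℝ]
    exact NormedSpace.expSeries_div_hasSum_exp (|t| * |x|)
  have key := hasSum_integral_of_dominated_convergence (μ := gaussianReal μ v)
    (F := fun (n : ℕ) (x : ℝ) => (f x : ℂ) * ((t * x * Complex.I) ^ n / n.factorial))
    (f := fun x => (f x : ℂ) * Complex.exp (t * x * Complex.I))
    (fun n x => (|t| * |x|) ^ n / n.factorial * |f x|) ?_ ?_ ?_ ?_ ?_
  · have z : ∀ n : ℕ, ∫ x, (f x : ℂ) * ((t * x * Complex.I) ^ n / n.factorial) ∂(gaussianReal μ v) = 0 := by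
      intro n
      have : (fun x : ℝ => (f x : ℂ) * ((t * x * Complex.I) ^ n / n.factorial)) =
          fun x => ((t * Complex.I) ^ n / n.factorial : ℂ) * ((x ^ n * f x : ℝ) : ℂ) := by
        funext x; push_cast; ring
      rw [this, integral_const_mul, integral_complex_ofReal, h0]; simp
    simp only [z] at key
    exact key.unique hasSum_zero
  · intro n
    have := hf.1
    exact (Complex.continuous_ofReal.comp_aestronglyMeasurable this).mul
      (Continuous.aestronglyMeasurable (by fun_prop))
  · intro n
    refine ae_of_all _ fun x => le_of_eq ?_
    simp [mul_pow]; ring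
  · exact ae_of_all _ fun x => (hs x).summable
  · simp_rw [fun x => (hs x).tsum_eq]
    exact hexp.integrable_mul hf.abs
  · refine ae_of_all _ fun x => HasSum.mul_left _ ?_
    rw [Complex.exp_eq_exp_ℂ]
    exact NormedSpace.expSeries_div_hasSum_exp (t * x * Complex.I)

lemma ae_zero_of_moments {μ : ℝ} {v : ℝ≥0} {f : ℝ → ℝ}
    (hf : MemLp f 2 (gaussianReal μ v))
    (h0 : ∀ j : ℕ, ∫ x, x ^ j * f x ∂(gaussianReal μ v) = 0) :
    f =ᵐ[gaussianReal μ v] 0 := by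
  have hfi : Integrable f (gaussianReal μ v) := hf.integrable (by norm_num)
  have hm1 : AEMeasurable (fun x => ENNReal.ofReal (f x)) (gaussianReal μ v) :=
    hfi.1.aemeasurable.ennreal_ofReal
  have hm2 : AEMeasurable (fun x => ENNReal.ofReal (-f x)) (gaussianReal μ v) :=
    hfi.1.aemeasurable.neg.ennreal_ofReal
  have f1 : ∫⁻ x, ENNReal.ofReal (f x) ∂(gaussianReal μ v) ≠ ∞ := hfi.lintegral_lt_top.ne
  have f2 : ∫⁻ x, ENNReal.ofReal (-f x) ∂(gaussianReal μ v) ≠ ∞ := hfi.neg.lintegral_lt_top.ne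
  have := isFiniteMeasure_withDensity f1
  have := isFiniteMeasure_withDensity f2
  have heq : (gaussianReal μ v).withDensity (fun x => ENNReal.ofReal (f x)) =
      (gaussianReal μ v).withDensity (fun x => ENNReal.ofReal (-f x)) := by
    apply Measure.ext_of_charFun
    funext t
    rw [charFun_apply_real, charFun_apply_real,
      integral_withDensity_eq_integral_toReal_smul₀ hm1 (ae_of_all _ fun _ => ENNReal.ofReal_lt_top),
      integral_withDensity_eq_integral_toReal_smul₀ hm2 (ae_of_all _ fun _ => ENNReal.ofReal_lt_top),
      ← sub_eq_zero]
    have ib : ∀ g : ℝ → ℝ, Integrable g (gaussianReal μ v) →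
        Integrable (fun x => (ENNReal.ofReal (g x)).toReal • Complex.exp (t * x * Complex.I))
          (gaussianReal μ v) := by
      intro g hg
      refine hg.abs.mono' ?_ (ae_of_all _ fun x => ?_)
      · exact (hg.1.aemeasurable.ennreal_ofReal.ennreal_toReal).aestronglyMeasurable.smul
          (Continuous.aestronglyMeasurable (by fun_prop))
      · rw [norm_smul, show (t * x * Complex.I : ℂ) = ((t * x : ℝ) : ℂ) * Complex.I by push_cast; ring,
          Complex.norm_exp_ofReal_mul_I, mul_one, ENNReal.toReal_ofReal', Real.norm_eq_abs,
          abs_of_nonneg (le_max_right _ _)]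
        exact max_le (le_abs_self _) (abs_nonneg _)
    have ibn := ib (fun x => -f x) hfi.neg
    rw [← integral_sub (ib f hfi) ibn, ← charFun_zero hf h0 t]
    congr 1; funext x
    rw [← sub_smul, ENNReal.toReal_ofReal', ENNReal.toReal_ofReal', Complex.real_smul]
    congr 2
    rcases le_total 0 (f x) with h | h
    · rw [max_eq_left h, max_eq_right (by linarith)]; ring
    · rw [max_eq_right h, max_eq_left (by linarith)]; ring
  have hae := (withDensity_eq_iff hm1 hm2 f1).1 heq
  filter_upwards [hae] with x hx
  have := congrArg ENNReal.toReal hx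
  simp only [ENNReal.toReal_ofReal'] at this
  simp only [Pi.zero_apply]
  rcases le_total 0 (f x) with h | h
  · rw [max_eq_left h, max_eq_right (by linarith)] at this; exact this
  · rw [max_eq_right h, max_eq_left (by linarith)] at this; linarith

lemma ae_zero_of_cf {μ : ℝ} {v : ℝ≥0} (hv : v ≠ 0) {f : ℝ → ℝ}
    (hf : MemLp f 2 (gaussianReal μ v)) (h0 : ∀ k, cf μ v k f = 0) :
    f =ᵐ[gaussianReal μ v] 0 := by
  apply ae_zero_of_moments hf
  intro j
  simpa [hp] using moments_zero hv hf h0 j 0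

/-- normalised Hermite functions in `L²` -/
def hb (μ : ℝ) (v : ℝ≥0) (k : ℕ) : Lp ℝ 2 (gaussianReal μ v) :=
  √((v : ℝ) ^ k / k.factorial) • (memLp_poly μ v (hp μ v k)).toLp _

lemma inner_hb {μ : ℝ} {v : ℝ≥0} (k : ℕ) (F : Lp ℝ 2 (gaussianReal μ v)) :
    inner ℝ (hb μ v k) F = √((v : ℝ) ^ k / k.factorial) * cf μ v k F := by
  rw [hb, inner_smul_left, L2.inner_def, cf]
  simp only [conj_trivial]
  congr 1
  apply integral_congr_ae
  filter_upwards [(memLp_poly μ v (hp μ v k)).coeFn_toLp] with x hx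
  rw [hx]; simp [mul_comm]

lemma cf_congr {μ : ℝ} {v : ℝ≥0} {k : ℕ} {f g : ℝ → ℝ} (h : f =ᵐ[gaussianReal μ v] g) :
    cf μ v k f = cf μ v k g := by
  apply integral_congr_ae
  filter_upwards [h] with x hx
  rw [hx]

lemma cf_const_mul {μ : ℝ} {v : ℝ≥0} {k : ℕ} (a : ℝ) (f : ℝ → ℝ) :
    cf μ v k (fun x => a * f x) = a * cf μ v k f := by
  unfold cf; rw [← integral_const_mul]; congr 1; funext x; ring

lemma hb_orthonormal {μ : ℝ} {v : ℝ≥0} (hv : v ≠ 0) : Orthonormal ℝ (hb μ v) := by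
  classical
  rw [orthonormal_iff_ite]
  intro i j
  rw [inner_hb]
  have e : (hb μ v j : ℝ → ℝ) =ᵐ[gaussianReal μ v]
      fun x => √((v : ℝ) ^ j / j.factorial) * (hp μ v j).eval x := by
    unfold hb
    filter_upwards [Lp.coeFn_smul (√((v : ℝ) ^ j / j.factorial)) ((memLp_poly μ v (hp μ v j)).toLp _),
      (memLp_poly μ v (hp μ v j)).coeFn_toLp] with x h1 h2
    rw [h1, Pi.smul_apply, h2, smul_eq_mul]
  rw [cf_congr e, cf_const_mul, cf_hp hv]
  by_cases h : i = j
  · subst h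
    simp only [if_true]
    have hv' : (0 : ℝ) < v := by positivity
    rw [← mul_assoc, Real.mul_self_sqrt (by positivity)]
    field_simp
  · simp [h]

lemma hb_complete {μ : ℝ} {v : ℝ≥0} (hv : v ≠ 0) :
    (Submodule.span ℝ (Set.range (hb μ v)))ᗮ = ⊥ := by
  rw [Submodule.eq_bot_iff]
  intro F hF
  have h0 : ∀ k, cf μ v k F = 0 := by
    intro k
    have := (Submodule.mem_orthogonal _ _).1 hF (hb μ v k) (Submodule.subset_span ⟨k, rfl⟩)
    rw [inner_hb] at this
    have hv' : (0 : ℝ) < v := by positivity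
    have hne : √((v : ℝ) ^ k / k.factorial) ≠ 0 := by positivity
    exact (mul_eq_zero.1 this).resolve_left hne
  exact (Lp.eq_zero_iff_ae_eq_zero).2 (ae_zero_of_cf hv (Lp.memLp F) h0)

lemma parseval {μ : ℝ} {v : ℝ≥0} (hv : v ≠ 0) {f : ℝ → ℝ}
    (hf : MemLp f 2 (gaussianReal μ v)) :
    HasSum (fun k : ℕ => cf μ v k f ^ 2 * (v : ℝ) ^ k / k.factorial)
      (∫ x, f x ^ 2 ∂(gaussianReal μ v)) := by
  set b := HilbertBasis.mkOfOrthogonalEqBot (hb_orthonormal (μ := μ) hv) (hb_complete hv) with hb'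
  have := b.hasSum_inner_mul_inner (hf.toLp f) (hf.toLp f)
  have hbk : ∀ k, b k = hb μ v k := fun k => by
    rw [hb', HilbertBasis.coe_mkOfOrthogonalEqBot]
  have e1 : (fun k : ℕ => cf μ v k f ^ 2 * (v : ℝ) ^ k / k.factorial) =
      fun k => inner ℝ (hf.toLp f) (b k) * inner ℝ (b k) (hf.toLp f) := by
    funext k
    rw [hbk, real_inner_comm, inner_hb, cf_congr hf.coeFn_toLp]
    have e : √((v : ℝ) ^ k / k.factorial) * √((v : ℝ) ^ k / k.factorial) = (v : ℝ) ^ k / k.factorial :=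
      Real.mul_self_sqrt (by positivity)
    linear_combination (-cf μ v k f ^ 2) * e
  have e2 : ∫ x, f x ^ 2 ∂(gaussianReal μ v) = inner ℝ (hf.toLp f) (hf.toLp f) := by
    rw [L2.inner_def]
    apply integral_congr_ae
    filter_upwards [hf.coeFn_toLp] with x hx
    rw [hx]; simp [sq]
  rw [e1, e2]
  exact this

lemma fall_zero (x : ℝ) : fall x 0 = 1 := by simp [fall]

lemma fall_succ (x : ℝ) (k : ℕ) : fall x (k + 1) = fall x k * (x - k) := by
  simp [fall, Finset.prod_range_succ]

lemma fall_succ' (x : ℝ) (k : ℕ) : fall x (k + 1) = x * fall (x - 1) k := by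
  unfold fall
  rw [Finset.prod_range_succ', mul_comm]
  congr 1
  · simp
  · apply Finset.prod_congr rfl; intro j _; push_cast; ring

lemma fall_pos {x : ℝ} {k : ℕ} (h : (k : ℝ) - 1 < x) : 0 < fall x k := by
  apply Finset.prod_pos
  intro j hj
  have : (j : ℝ) + 1 ≤ k := by exact_mod_cast Finset.mem_range.1 hj
  linarith

lemma fall_add (x : ℝ) (a b : ℕ) : fall x (a + b) = fall x a * fall (x - a) b := by
  induction b with
  | zero => simp [fall_zero]
  | succ b ih => rw [← add_assoc, fall_succ, ih, fall_succ]; push_cast; ring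

lemma fall_nat (m k : ℕ) : fall (m : ℝ) k = (m.choose k : ℝ) * k.factorial := by
  induction k generalizing m with
  | zero => simp [fall_zero]
  | succ k ih =>
    rcases m with _ | m
    · rw [fall_succ']; simp
    · rw [fall_succ']
      have := ih m
      rw [show ((m + 1 : ℕ) : ℝ) - 1 = m by push_cast; ring, this]
      have h := Nat.add_one_mul_choose_eq m k
      have h' : ((m : ℝ) + 1) * m.choose k = (m + 1).choose (k + 1) * (k + 1) := by exact_mod_cast h
      rw [Nat.factorial_succ]; push_cast
      linear_combination (k.factorial : ℝ) * h'

/-- the alternating sum -/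
def FF (n : ℕ) (N k : ℝ) : ℝ :=
  ∑ i ∈ Finset.range (n + 1), (-1 : ℝ) ^ i * (n.choose i : ℝ) * fall k i / fall N i

lemma FF_succ (n : ℕ) (N k : ℝ) : FF (n + 1) N k = FF n N k - k / N * FF n (N - 1) (k - 1) := by
  have e : FF n N k = ∑ i ∈ Finset.range (n + 1),
      (-1 : ℝ) ^ (i + 1) * (n.choose (i + 1) : ℝ) * fall k (i + 1) / fall N (i + 1) + 1 := by
    unfold FF
    have := Finset.sum_range_succ' (fun i => (-1 : ℝ) ^ i * (n.choose i : ℝ) * fall k i / fall N i) (n + 1)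
    rw [Finset.sum_range_succ] at this
    simpa [fall_zero] using this
  rw [e]
  unfold FF
  rw [Finset.sum_range_succ', Finset.mul_sum]
  simp only [fall_zero, pow_zero, Nat.choose_zero_right, Nat.cast_one, mul_one, div_one]
  rw [add_sub_right_comm, ← Finset.sum_sub_distrib]
  congr 1
  apply Finset.sum_congr rfl
  intro i _
  rw [Nat.choose_succ_succ, fall_succ', fall_succ']
  push_cast
  rw [mul_div_mul_comm, mul_div_mul_comm, pow_succ] <;> ring

lemma FF_eq (n : ℕ) (N k : ℝ) (h : (n : ℝ) - 1 < N) : FF n N k = fall (N - k) n / fall N n := by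
  induction n generalizing N k with
  | zero => simp [FF, fall_zero]
  | succ n ih =>
    push_cast at h
    rw [FF_succ, ih N k (by linarith), ih (N - 1) (k - 1) (by linarith),
      show N - 1 - (k - 1) = N - k by ring]
    have hn : (0:ℝ) ≤ n := by positivity
    have hN : N ≠ 0 := by linarith
    have h1 : fall N n ≠ 0 := (fall_pos (by linarith)).ne'
    have h2 : fall (N - 1) n ≠ 0 := (fall_pos (by linarith)).ne'
    have h3 : fall N (n + 1) ≠ 0 := (fall_pos (by push_cast; linarith)).ne'
    have h4 : N - n ≠ 0 := by linarith
    have e : fall N n * (N - n) = N * fall (N - 1) n := by rw [← fall_succ, fall_succ']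
    have e2 : fall N n = N * fall (N - 1) n / (N - n) := by rw [← e]; field_simp
    rw [fall_succ, fall_succ', e2]
    field_simp
    ring

/-- coefficients -/
def dd (m n k : ℕ) : ℝ :=
  FF n (m + n) k - (if k ≤ m then (m.choose k : ℝ) * k.factorial / fall (m + n) k else 0)

lemma dd_zero (m n k : ℕ) (hk : k ≤ m + n) : dd m n k = 0 := by
  have hm : (0:ℝ) ≤ m := by positivity
  unfold dd
  rw [FF_eq _ _ _ (by linarith)]
  have h1 : fall ((m : ℝ) + n) n ≠ 0 := (fall_pos (by linarith)).ne'
  have hk' : (k : ℝ) ≤ m + n := by exact_mod_cast hk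
  have h2 : fall ((m : ℝ) + n) k ≠ 0 := (fall_pos (by linarith)).ne'
  split_ifs with h
  · rw [← fall_nat, sub_eq_zero, div_eq_div_iff h1 h2]
    have a := fall_add ((m : ℝ) + n) k n
    have b := fall_add ((m : ℝ) + n) n k
    rw [add_comm n k, show (m : ℝ) + n - n = m by ring] at b
    linear_combination b - a
  · rw [sub_zero, show (m : ℝ) + n - k = ((m + n - k : ℕ) : ℝ) by push_cast [hk]; ring, fall_nat,
      Nat.choose_eq_zero_of_lt (by omega)]
    simp

lemma dd_pos (m n k : ℕ) (hk : m + n < k) : 0 < (-1 : ℝ) ^ n * dd m n k := by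
  have hm : (0:ℝ) ≤ m := by positivity
  unfold dd
  rw [FF_eq _ _ _ (by linarith), if_neg (by omega), sub_zero, ← mul_div_assoc]
  apply div_pos _ (fall_pos (by linarith))
  have : (-1 : ℝ) ^ n * fall ((m : ℝ) + n - k) n = ∏ j ∈ Finset.range n, (k - m - n + j : ℝ) := by
    unfold fall
    conv_lhs => rw [← Finset.card_range n, ← Finset.prod_const, Finset.card_range]
    rw [← Finset.prod_mul_distrib]
    apply Finset.prod_congr rfl; intro j _; ring
  rw [this]
  apply Finset.prod_pos
  intro j _
  have : (m : ℝ) + n < k := by exact_mod_cast hk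
  have : (0:ℝ) ≤ j := by positivity
  linarith
open scoped NNReal ENNReal

lemma cf_chain {μ : ℝ} {v : ℝ≥0} (hv : v ≠ 0) {gd : ℕ → ℝ → ℝ} {L : ℕ}
    (H : ∀ i < L, ACd (gd i) (gd (i + 1))) (i : ℕ) (hi : i ≤ L) (k : ℕ)
    (hw : Wk μ v k (gd i)) : cf μ v k (gd i) = cf μ v (k + i) (gd 0) := by
  induction i generalizing k with
  | zero => rfl
  | succ i ih =>
    rw [cf_step hv (H i (by omega)) hw, ih (by omega) _ (Wk.step hv (H i (by omega)) hw)]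
    congr 1; omega

lemma memLp_chain {μ : ℝ} {v : ℝ≥0} (hv : v ≠ 0) {gd : ℕ → ℝ → ℝ} {L n : ℕ} (hn : 1 ≤ n)
    (hL : n ≤ L) (H : ∀ i < L, ACd (gd i) (gd (i + 1)))
    (h2 : Integrable (fun x => gd n x ^ 2) (gaussianReal μ v)) (i : ℕ) (hi : i ≤ n) :
    MemLp (gd i) 2 (gaussianReal μ v) := by
  have key : ∀ j, j ≤ n → Integrable (fun x => gd (n - j) x ^ 2) (gaussianReal μ v) := by
    intro j
    induction j with
    | zero => intro _; simpa using h2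
    | succ j ih =>
      intro hj
      have := ih (by omega)
      have e : n - j = (n - (j + 1)) + 1 := by omega
      rw [e] at this
      exact L2_step hv (H _ (by omega)) this
  have hk := key (n - i) (by omega)
  rw [show n - (n - i) = i by omega] at hk
  rw [memLp_two_iff_integrable_sq]
  · exact hk
  · rcases i with _ | i
    · exact (H 0 (by omega)).continuous.aestronglyMeasurable
    · exact (H i (by omega)).aesm.mono_ac (gaussianReal_absolutelyContinuous μ hv)

/-- Hermite weights of `h` -/
def aw (μ : ℝ) (v : ℝ≥0) (h : ℝ → ℝ) (k : ℕ) : ℝ := cf μ v k h ^ 2 * (v : ℝ) ^ k / k.factorial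

lemma aw_nonneg (μ : ℝ) (v : ℝ≥0) (h : ℝ → ℝ) (k : ℕ) : 0 ≤ aw μ v h k := by
  unfold aw; positivity

lemma aw_eq_zero {μ : ℝ} {v : ℝ≥0} (hv : v ≠ 0) {h : ℝ → ℝ} {k : ℕ} :
    aw μ v h k = 0 ↔ cf μ v k h = 0 := by
  unfold aw; simp [hv, Nat.factorial_ne_zero]

lemma fall_mul_factorial (j i : ℕ) :
    fall ((j + i : ℕ) : ℝ) i * j.factorial = (j + i).factorial := by
  rw [fall_nat]
  have := Nat.choose_mul_factorial_mul_factorial (Nat.le_add_left i j)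
  rw [Nat.add_sub_cancel] at this
  exact_mod_cast this

lemma sq_sum {μ : ℝ} {v : ℝ≥0} (hv : v ≠ 0) {gd : ℕ → ℝ → ℝ} {L : ℕ}
    (H : ∀ i < L, ACd (gd i) (gd (i + 1))) (i : ℕ) (hi : i ≤ L)
    (hm : MemLp (gd i) 2 (gaussianReal μ v)) :
    HasSum (fun k : ℕ => aw μ v (gd 0) k * fall k i)
      ((v : ℝ) ^ i * ∫ x, gd i x ^ 2 ∂(gaussianReal μ v)) := by
  have h := (parseval hv hm).mul_left ((v : ℝ) ^ i)
  have e : (fun j : ℕ => (v : ℝ) ^ i * (cf μ v j (gd i) ^ 2 * (v : ℝ) ^ j / j.factorial)) =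
      fun j => (fun k : ℕ => aw μ v (gd 0) k * fall k i) (j + i) := by
    funext j
    simp only [aw]
    rw [cf_chain hv H i hi j (Wk_of_memLp hm j), ← fall_mul_factorial j i]
    have : fall ((j + i : ℕ) : ℝ) i ≠ 0 := by
      intro h0
      have := fall_mul_factorial j i
      rw [h0, zero_mul] at this
      exact Nat.factorial_ne_zero (j + i) (by exact_mod_cast this.symm)
    have hj : (j.factorial : ℝ) ≠ 0 := by exact_mod_cast Nat.factorial_ne_zero j
    field_simp
    ring
  rw [e, hasSum_nat_add_iff (f := fun k : ℕ => aw μ v (gd 0) k * fall k i) i] at h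
  have z : ∑ k ∈ Finset.range i, aw μ v (gd 0) k * fall k i = 0 := by
    apply Finset.sum_eq_zero
    intro k hk
    rw [fall_nat, Nat.choose_eq_zero_of_lt (Finset.mem_range.1 hk)]; simp
  rw [z, add_zero] at h
  exact h

lemma mean_sq {μ : ℝ} {v : ℝ≥0} (hv : v ≠ 0) {gd : ℕ → ℝ → ℝ} {L : ℕ}
    (H : ∀ i < L, ACd (gd i) (gd (i + 1))) (i : ℕ) (hi : i ≤ L)
    (hm : Integrable (gd i) (gaussianReal μ v)) :
    (v : ℝ) ^ i * (∫ x, gd i x ∂(gaussianReal μ v)) ^ 2 = i.factorial * aw μ v (gd 0) i := by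
  have hw : Wk μ v 0 (gd i) := by
    intro j hj
    obtain rfl : j = 0 := by omega
    simpa using hm
  have := cf_chain hv H i hi 0 hw
  rw [zero_add] at this
  have e : cf μ v 0 (gd i) = ∫ x, gd i x ∂(gaussianReal μ v) := by simp [cf, hp]
  rw [← e, this, aw]
  have hj : (i.factorial : ℝ) ≠ 0 := by exact_mod_cast Nat.factorial_ne_zero i
  field_simp

lemma main_sum {μ : ℝ} {v : ℝ≥0} (hv : v ≠ 0) {σ : ℝ} (hσ : (v : ℝ) = σ ^ 2) {gd : ℕ → ℝ → ℝ}
    {m n : ℕ} (hn : 1 ≤ n)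
    (H : ∀ i < max m n, ACd (gd i) (gd (i + 1)))
    (h2 : Integrable (fun x => gd n x ^ 2) (gaussianReal μ v))
    (h1 : ∀ i, n < i → i ≤ m → Integrable (fun x => |gd i x|) (gaussianReal μ v)) :
    HasSum (fun k => aw μ v (gd 0) k * dd m n k)
      (variance (gd 0) (gaussianReal μ v) - SnormalBound (gaussianReal μ v) σ m n gd) := by
  have hL : n ≤ max m n := le_max_right _ _
  have hm : ∀ i, i ≤ n → MemLp (gd i) 2 (gaussianReal μ v) := memLp_chain hv hn hL H h2
  have hI : ∀ i, i ≤ m → Integrable (gd i) (gaussianReal μ v) := by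
    intro i hi
    rcases le_or_gt i n with h | h
    · exact (hm i h).integrable (by norm_num)
    · rw [← integrable_norm_iff]
      · exact h1 i h hi
      · obtain ⟨j, rfl⟩ : ∃ j, i = j + 1 := ⟨i - 1, by omega⟩
        exact (H j (by omega)).aesm.mono_ac (gaussianReal_absolutelyContinuous μ hv)
  set N : ℝ := (m : ℝ) + n with hN
  have s1 : HasSum (fun k : ℕ => aw μ v (gd 0) k * FF n N k)
      (∑ i ∈ Finset.range (n + 1), (-1 : ℝ) ^ i * (n.choose i : ℝ) / fall N i *
        ((v : ℝ) ^ i * ∫ x, gd i x ^ 2 ∂(gaussianReal μ v))) := by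
    have := hasSum_sum (s := Finset.range (n + 1)) (fun i hi =>
      (sq_sum hv H i (by have := Finset.mem_range.1 hi; omega)
        (hm i (by have := Finset.mem_range.1 hi; omega))).mul_left
          ((-1 : ℝ) ^ i * (n.choose i : ℝ) / fall N i))
    refine this.congr_fun ?_
    intro k
    rw [FF, Finset.mul_sum]
    apply Finset.sum_congr rfl; intro i _; ring
  have s2 : HasSum (fun k : ℕ => aw μ v (gd 0) k *
      (if k ≤ m then (m.choose k : ℝ) * k.factorial / fall N k else 0))
      (∑ i ∈ Finset.range (m + 1), (m.choose i : ℝ) / fall N i *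
        ((v : ℝ) ^ i * (∫ x, gd i x ∂(gaussianReal μ v)) ^ 2)) := by
    have e : ∑ i ∈ Finset.range (m + 1), (m.choose i : ℝ) / fall N i *
        ((v : ℝ) ^ i * (∫ x, gd i x ∂(gaussianReal μ v)) ^ 2) =
        ∑ k ∈ Finset.range (m + 1), aw μ v (gd 0) k *
      (if k ≤ m then (m.choose k : ℝ) * k.factorial / fall N k else 0) := by
      apply Finset.sum_congr rfl
      intro i hi
      have hi' : i ≤ m := by have := Finset.mem_range.1 hi; omega
      rw [mean_sq hv H i (by omega) (hI i hi'), if_pos hi']; ring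
    rw [e]
    apply hasSum_sum_of_ne_finset_zero
    intro k hk
    rw [Finset.mem_range] at hk
    rw [if_neg (by omega), mul_zero]
  have s := s1.sub s2
  have ev : variance (gd 0) (gaussianReal μ v) - SnormalBound (gaussianReal μ v) σ m n gd =
      (∑ i ∈ Finset.range (n + 1), (-1 : ℝ) ^ i * (n.choose i : ℝ) / fall N i *
        ((v : ℝ) ^ i * ∫ x, gd i x ^ 2 ∂(gaussianReal μ v))) -
      (∑ i ∈ Finset.range (m + 1), (m.choose i : ℝ) / fall N i *
        ((v : ℝ) ^ i * (∫ x, gd i x ∂(gaussianReal μ v)) ^ 2)) := by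
    rw [variance_eq_sub (hm 0 (by omega)), SnormalBound, Finset.sum_range_succ',
      Finset.sum_range_succ', ← Finset.Ico_add_one_right_eq_Icc, ← Finset.Ico_add_one_right_eq_Icc,
      Finset.sum_Ico_eq_sum_range, Finset.sum_Ico_eq_sum_range]
    have e1 : ∀ i, (-1 : ℝ) ^ (1 + i - 1) * ((n.choose (1 + i) : ℝ) * σ ^ (2 * (1 + i)) / fall N (1 + i)) *
        ∫ x, (gd (1 + i) x) ^ 2 ∂(gaussianReal μ v) =
        - ((-1 : ℝ) ^ (i + 1) * (n.choose (i + 1) : ℝ) / fall N (i + 1) *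
        ((v : ℝ) ^ (i + 1) * ∫ x, gd (i + 1) x ^ 2 ∂(gaussianReal μ v))) := by
      intro i
      rw [add_comm 1 i, Nat.add_sub_cancel, hσ, ← pow_mul]; ring
    have e2 : ∀ i, (m.choose (1 + i) : ℝ) * σ ^ (2 * (1 + i)) / fall N (1 + i) *
        (∫ x, gd (1 + i) x ∂(gaussianReal μ v)) ^ 2 =
        (m.choose (i + 1) : ℝ) / fall N (i + 1) *
        ((v : ℝ) ^ (i + 1) * (∫ x, gd (i + 1) x ∂(gaussianReal μ v)) ^ 2) := by
      intro i
      rw [add_comm 1 i, hσ, ← pow_mul]; ring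
    simp only [← hN, e1, e2, Finset.sum_neg_distrib, Nat.add_sub_cancel]
    simp only [Pi.pow_apply, fall_zero, pow_zero, Nat.choose_zero_right, Nat.cast_one]
    ring
  rw [ev]
  refine s.congr_fun ?_
  intro k
  rw [dd]; ring

lemma poly_of_cf {μ : ℝ} {v : ℝ≥0} (hv : v ≠ 0) {f : ℝ → ℝ} (hc : Continuous f)
    (hf : MemLp f 2 (gaussianReal μ v)) {d : ℕ} (h0 : ∀ k, d < k → cf μ v k f = 0) :
    ∃ p : Polynomial ℝ, p.natDegree ≤ d ∧ ∀ x, f x = p.eval x := by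
  have hv' : (v : ℝ) ≠ 0 := by exact_mod_cast hv
  set p : Polynomial ℝ := ∑ j ∈ Finset.range (d + 1),
    Polynomial.C (cf μ v j f * (v : ℝ) ^ j / j.factorial) * hp μ v j with hpdef
  refine ⟨p, ?_, ?_⟩
  · apply Polynomial.natDegree_sum_le_of_forall_le
    intro j hj
    have := Finset.mem_range.1 hj
    exact (Polynomial.natDegree_C_mul_le _ _).trans ((natDegree_hp μ v j).trans (by omega))
  · have hcp : ∀ k, cf μ v k (fun x => p.eval x) = cf μ v k f := by
      intro k
      have e : cf μ v k (fun x => p.eval x) = ∑ j ∈ Finset.range (d + 1),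
          (cf μ v j f * (v : ℝ) ^ j / j.factorial) * cf μ v k (fun x => (hp μ v j).eval x) := by
        simp_rw [← cf_const_mul]
        unfold cf
        rw [← integral_finsetSum]
        · congr 1; funext x
          simp only []
          rw [hpdef, Polynomial.eval_finsetSum, Finset.mul_sum]
          simp [cf]
        · intro j _
          have := int_poly_mul (memLp_poly μ v (Polynomial.C (cf μ v j f * (v : ℝ) ^ j / j.factorial) *
            hp μ v j)) (hp μ v k)
          simpa [cf] using this
      rw [e]
      simp_rw [cf_hp hv]
      have hk : (k.factorial : ℝ) ≠ 0 := by exact_mod_cast Nat.factorial_ne_zero k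
      by_cases hkd : k ≤ d
      · rw [Finset.sum_eq_single k]
        · simp; field_simp
        · intro j _ hj; simp [hj.symm]
        · intro hk'; simp at hk'; omega
      · rw [h0 k (by omega)]
        apply Finset.sum_eq_zero
        intro j hj
        have := Finset.mem_range.1 hj
        rw [if_neg (by omega), mul_zero]
    have hd : MemLp (fun x => f x - p.eval x) 2 (gaussianReal μ v) := hf.sub (memLp_poly μ v p)
    have hz : ∀ k, cf μ v k (fun x => f x - p.eval x) = 0 := by
      intro k
      have h := hcp k
      unfold cf at h ⊢
      simp_rw [mul_sub]
      rw [integral_sub (int_poly_mul hf _) (int_poly_mul (memLp_poly μ v p) _), h, sub_self]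
    have hae := (gaussianReal_absolutelyContinuous' μ hv).ae_le (ae_zero_of_cf hv hd hz)
    have := (Continuous.ae_eq_iff_eq volume (hc.sub (by fun_prop : Continuous fun x => p.eval x))
      continuous_zero).1 hae
    intro x
    have := congrFun this x
    simp at this
    linarith

lemma main_gauss {μ : ℝ} {v : ℝ≥0} (hv : v ≠ 0) {σ : ℝ} (hσ : (v : ℝ) = σ ^ 2) {gd : ℕ → ℝ → ℝ}
    {m n : ℕ} (hn : 1 ≤ n)
    (H : ∀ i < max m n, ACd (gd i) (gd (i + 1)))
    (h2 : Integrable (fun x => gd n x ^ 2) (gaussianReal μ v))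
    (h1 : ∀ i, n < i → i ≤ m → Integrable (fun x => |gd i x|) (gaussianReal μ v)) :
    0 ≤ (-1 : ℝ) ^ n * (variance (gd 0) (gaussianReal μ v) -
        SnormalBound (gaussianReal μ v) σ m n gd) ∧
      (variance (gd 0) (gaussianReal μ v) = SnormalBound (gaussianReal μ v) σ m n gd ↔
        IsPolyOn (gd 0) Set.univ (m + n)) := by
  have hs := (main_sum hv hσ hn H h2 h1).mul_left ((-1 : ℝ) ^ n)
  have hnn : ∀ k, 0 ≤ (-1 : ℝ) ^ n * (aw μ v (gd 0) k * dd m n k) := by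
    intro k
    rcases le_or_gt k (m + n) with h | h
    · simp [dd_zero m n k h]
    · rw [mul_left_comm]
      exact mul_nonneg (aw_nonneg _ _ _ _) (dd_pos m n k h).le
  have hm0 := memLp_chain hv hn (le_max_right m n) H h2 0 (by omega)
  have hc0 : Continuous (gd 0) := (H 0 (lt_of_lt_of_le hn (le_max_right m n))).continuous
  refine ⟨hs.nonneg hnn, ?_⟩
  rw [← sub_eq_zero]
  constructor
  · intro h
    rw [h, mul_zero, hasSum_zero_iff_of_nonneg hnn] at hs
    obtain ⟨p, hp1, hp2⟩ := poly_of_cf hv hc0 hm0 (d := m + n) (fun k hk => by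
      have := congrFun hs k
      rw [← aw_eq_zero hv]
      have hd := (dd_pos m n k hk).ne'
      simp only [Pi.zero_apply] at this
      rw [mul_left_comm] at this
      exact (mul_eq_zero.1 this).resolve_right hd)
    exact ⟨p, hp1, fun x _ => hp2 x⟩
  · rintro ⟨p, hp1, hp2⟩
    have e : gd 0 = fun x => p.eval x := funext fun x => hp2 x (Set.mem_univ x)
    have z : (fun k => aw μ v (gd 0) k * dd m n k) = fun _ => 0 := by
      funext k
      rcases le_or_gt k (m + n) with h | h
      · rw [dd_zero m n k h, mul_zero]
      · rw [(aw_eq_zero hv).2, zero_mul]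
        rw [e]; exact cf_poly_zero hv k p (by omega)
    have := main_sum hv hσ hn H h2 h1
    rw [z] at this
    exact this.unique hasSum_zero

/-- **Theorem 2.1 for the normal distribution.** -/
theorem normal_variance_bound
    (μ σ : ℝ) (hσ : 0 < σ) (P : Measure ℝ)
    (hP : P = volume.withDensity (fun x => ENNReal.ofReal (normalDensity μ σ x)))
    (m n : ℕ) (hn : 1 ≤ n) (gd : ℕ → ℝ → ℝ)
    (hg : MemH P (fun _ => 1) Set.univ m n gd) :
    0 ≤ (-1 : ℝ) ^ n * (variance (gd 0) P - SnormalBound P σ m n gd) ∧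
      (variance (gd 0) P = SnormalBound P σ m n gd ↔
        IsPolyOn (gd 0) Set.univ (m + n)) := by
  obtain ⟨v, hv⟩ : ∃ v : ℝ≥0, (v : ℝ) = σ ^ 2 := ⟨⟨σ ^ 2, sq_nonneg σ⟩, rfl⟩
  have hv0 : v ≠ 0 := by
    intro h
    rw [h] at hv
    have : 0 < σ ^ 2 := by positivity
    rw [← hv] at this
    simp at this
  have hPG : P = gaussianReal μ v := by
    rw [hP, gaussianReal_of_var_ne_zero μ hv0]
    congr 1
    funext x
    rw [gaussianPDF, gaussianPDFReal, normalDensity, hv, Real.sqrt_mul (by positivity) (σ ^ 2),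
      Real.sqrt_sq hσ.le]
  subst hPG
  obtain ⟨g1, g2, g3, g4, g5⟩ := hg
  have hl : 1 ≤ max m n := hn.trans (le_max_right _ _)
  have hcont : ∀ k, k < max m n → Continuous (gd k) := by
    intro k hk
    rcases Nat.lt_or_ge (k + 1) (max m n) with h | h
    · exact continuous_iff_continuousAt.2 fun x => (g1 k h x (Set.mem_univ x)).continuousAt
    · have : k = max m n - 1 := by omega
      rw [this]
      exact continuousOn_univ.1 (g2 hl)
  refine main_gauss hv0 hv hn ?_ ?_ ?_
  · intro i hi
    rcases Nat.lt_or_ge (i + 1) (max m n) with h | h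
    · exact ACd.of_hasDerivAt (fun x => g1 i h x (Set.mem_univ x)) (hcont _ h)
    · intro a b
      have := g3 hl a (Set.mem_univ a) b (Set.mem_univ b)
      rw [show max m n - 1 = i by omega, show max m n = i + 1 by omega] at this
      exact this
  · simpa using g4
  · intro i h1 h2
    simpa using g5 i h1 h2

end
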